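/- Let E(λ)=A+λB be an n×n *-anti-palindromic matrix pencil over ℂ (i.e., A^*=−B) whose rank equals r (r ≤ n). Then there exist nonnegative integers ℓ, s with ℓ+2s=r, real numbers a_1,…,a_ℓ, b_1,…,b_ℓ, vectors u_1,…,u_ℓ, v_1,…,v_s ∈ ℂ^n, and vector pencils w_1,…,w_s of degree at most one such that A+λB = Σ_{i=1}^{ℓ} ( (a_i+i b_i) + λ(−a_i+i b_i) ) u_i u_i^* + Σ_{j=1}^{s} ( v_j w_j(λ)^* − (rev w_j)(λ) v_j^* ), where i denotes the imaginary unit. -/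

import Mathlib

open Matrix BigOperators

/-- The rank of the pencil `A + λ B` (the maximum over `μ ∈ ℂ` of the rank of
`A + μ B`) equals `r`. -/
def PencilRankEq (n : ℕ) (A B : Matrix (Fin n) (Fin n) ℂ) (r : ℕ) : Prop :=
  (∃ μ : ℂ, (A + μ • B).rank = r) ∧ ∀ μ : ℂ, (A + μ • B).rank ≤ r

/-- `A` is a sum of `ℓ` scaled Hermitian rank-one matrices and `s` matrices
`v c^* - d v^*`, where `ℓ + 2 s = r`. -/
def HasStarDecomposition {n : ℕ} (A : Matrix (Fin n) (Fin n) ℂ) (r : ℕ) : Prop :=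
  ∃ (ℓ s : ℕ), ℓ + 2 * s = r ∧
    ∃ (z : Fin ℓ → ℂ) (u : Fin ℓ → Fin n → ℂ) (v c d : Fin s → Fin n → ℂ),
      A = (∑ i, z i • vecMulVec (u i) (star (u i)))
        + ∑ j, (vecMulVec (v j) (star (c j)) - vecMulVec (d j) (star (v j)))

namespace HasStarDecomposition

variable {n : ℕ} {A : Matrix (Fin n) (Fin n) ℂ} {r : ℕ}

theorem zero (n r : ℕ) : HasStarDecomposition (0 : Matrix (Fin n) (Fin n) ℂ) r :=
  ⟨r, 0, by simp, 0, 0, 0, 0, 0, by simp⟩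

theorem smul_vecMulVec_add (h : HasStarDecomposition A r) (z : ℂ) (u : Fin n → ℂ) :
    HasStarDecomposition (z • vecMulVec u (star u) + A) (r + 1) := by
  obtain ⟨ℓ, s, hr, zs, us, v, c, d, rfl⟩ := h
  refine ⟨ℓ + 1, s, by omega, Fin.cons z zs, Fin.cons u us, v, c, d, ?_⟩
  simp [Fin.sum_univ_succ, add_assoc]

theorem vecMulVec_sub_add (h : HasStarDecomposition A r) (v c d : Fin n → ℂ) :
    HasStarDecomposition (vecMulVec v (star c) - vecMulVec d (star v) + A) (r + 2) := by
  obtain ⟨ℓ, s, hr, z, u, vs, cs, ds, rfl⟩ := h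
  refine ⟨ℓ, s + 1, by omega, z, u, Fin.cons v vs, Fin.cons c cs, Fin.cons d ds, ?_⟩
  simp only [Fin.sum_univ_succ, Fin.cons_zero, Fin.cons_succ]
  abel

end HasStarDecomposition

section RankDrop

open scoped ComplexOrder

variable {n : ℕ} {M M' : Matrix (Fin n) (Fin n) ℂ}

theorem rank_add_finrank_ker_mulVecLin (M : Matrix (Fin n) (Fin n) ℂ) :
    M.rank + Module.finrank ℂ (LinearMap.ker M.mulVecLin) = n := by
  have h := M.mulVecLin.finrank_range_add_finrank_ker
  rwa [Module.finrank_fin_fun] at h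

theorem rank_add_one_le_of_ker_le (hker : ∀ y, M *ᵥ y = 0 → M' *ᵥ y = 0) {x : Fin n → ℂ}
    (hx' : M' *ᵥ x = 0) (hx : M *ᵥ x ≠ 0) : M'.rank + 1 ≤ M.rank := by
  have hlt : LinearMap.ker M.mulVecLin < LinearMap.ker M'.mulVecLin :=
    SetLike.lt_iff_le_and_exists.2 ⟨fun y hy => hker y hy, x, hx', hx⟩
  have := Submodule.finrank_lt_finrank_of_lt hlt
  have := rank_add_finrank_ker_mulVecLin M
  have := rank_add_finrank_ker_mulVecLin M'
  omega

theorem rank_add_two_le_of_ker_le (hker : ∀ y, M *ᵥ y = 0 → M' *ᵥ y = 0) {x v : Fin n → ℂ}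
    (hx' : M' *ᵥ x = 0) (hx : M *ᵥ x ≠ 0) (hv' : M' *ᵥ v = 0) (hv : v ≠ 0)
    (hperp : ∀ y, M *ᵥ y = 0 → star v ⬝ᵥ y = 0) (hxv : star v ⬝ᵥ x = 0) :
    M'.rank + 2 ≤ M.rank := by
  set L := LinearMap.ker M.mulVecLin ⊔ Submodule.span ℂ {x}
  have hxL : x ∈ L := Submodule.mem_sup_right (Submodule.mem_span_singleton_self x)
  have hlt : LinearMap.ker M.mulVecLin < L :=
    SetLike.lt_iff_le_and_exists.2 ⟨le_sup_left, x, hxL, hx⟩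
  have hvL : v ∉ L := by
    intro hmem
    obtain ⟨y, hy, w, hw, hyw⟩ := Submodule.mem_sup.1 hmem
    obtain ⟨a, rfl⟩ := Submodule.mem_span_singleton.1 hw
    have h0 : star v ⬝ᵥ v = 0 := by
      conv_lhs => rw [← hyw, dotProduct_add, dotProduct_smul, hyw]
      rw [hperp y hy, hxv, smul_zero, add_zero]
    exact hv (dotProduct_star_self_eq_zero.1 h0)
  have hle : L ≤ LinearMap.ker M'.mulVecLin :=
    sup_le (fun y hy => hker y hy) ((Submodule.span_singleton_le_iff_mem _ _).2 hx')
  have hlt' : L < LinearMap.ker M'.mulVecLin :=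
    SetLike.lt_iff_le_and_exists.2 ⟨hle, v, hv', hvL⟩
  have := Submodule.finrank_lt_finrank_of_lt hlt
  have := Submodule.finrank_lt_finrank_of_lt hlt'
  have := rank_add_finrank_ker_mulVecLin M
  have := rank_add_finrank_ker_mulVecLin M'
  omega

end RankDrop

section Pencil

open scoped ComplexOrder

variable {n : ℕ}

theorem star_dotProduct_mulVec_eq (A : Matrix (Fin n) (Fin n) ℂ) (x y : Fin n → ℂ) :
    star x ⬝ᵥ A *ᵥ y = star (Aᴴ *ᵥ x) ⬝ᵥ y := by
  rw [star_mulVec, conjTranspose_conjTranspose, dotProduct_mulVec]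

/-- A nonzero pencil spanned by `A` and `Aᴴ` has an eigenvector which is not a common null
vector. -/
theorem exists_mulVec_eq_smul_and_conjTranspose_mulVec_eq_smul
    {A : Matrix (Fin n) (Fin n) ℂ} (hA : A ≠ 0) :
    ∃ (x v : Fin n → ℂ) (p q : ℂ),
      v ≠ 0 ∧ (p ≠ 0 ∨ q ≠ 0) ∧ A *ᵥ x = p • v ∧ Aᴴ *ᵥ x = q • v := by
  let R : Submodule ℂ (Fin n → ℂ) :=
    { carrier := {y | ∀ z, A *ᵥ z = 0 → Aᴴ *ᵥ z = 0 → star z ⬝ᵥ y = 0}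
      add_mem' := fun {a b} ha hb z h1 h2 => by
        rw [dotProduct_add, ha z h1 h2, hb z h1 h2, add_zero]
      zero_mem' := fun z _ _ => dotProduct_zero _
      smul_mem' := fun a y hy z h1 h2 => by
        rw [dotProduct_smul, hy z h1 h2, smul_zero] }
  have hAR : ∀ y, A *ᵥ y ∈ R := fun y z _ h2 => by
    rw [star_dotProduct_mulVec_eq, h2, star_zero, zero_dotProduct]
  have hAR' : ∀ y, Aᴴ *ᵥ y ∈ R := fun y z h1 _ => by
    rw [star_dotProduct_mulVec_eq, conjTranspose_conjTranspose, h1, star_zero, zero_dotProduct]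
  have hR : ∀ y ∈ R, A *ᵥ y = 0 → Aᴴ *ᵥ y = 0 → y = 0 := fun y hy h1 h2 =>
    dotProduct_star_self_eq_zero.1 (hy y h1 h2)
  by_cases hinj : ∀ x ∈ R, A *ᵥ x = 0 → x = 0
  · let f : R →ₗ[ℂ] R := A.mulVecLin.restrict fun y _ => hAR y
    let g : R →ₗ[ℂ] R := Aᴴ.mulVecLin.restrict fun y _ => hAR' y
    have hf : Function.Injective f := by
      rw [injective_iff_map_eq_zero]
      intro y hy
      exact Subtype.ext (hinj y y.2 (congrArg Subtype.val hy))
    obtain ⟨y, hy⟩ : ∃ y, A *ᵥ y ≠ 0 := by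
      by_contra! h
      exact hA (Matrix.mulVec_injective (by ext1 y; simp [h y]))
    have : Nontrivial R := ⟨⟨A *ᵥ y, hAR y⟩, 0, fun h => hy (congrArg Subtype.val h)⟩
    let e := LinearEquiv.ofInjectiveEndo f hf
    obtain ⟨μ, hμ⟩ := Module.End.exists_eigenvalue (e.symm.toLinearMap ∘ₗ g : Module.End ℂ R)
    obtain ⟨x, hx⟩ := hμ.exists_hasEigenvector
    have hgx : g x = μ • f x := by
      have h := congrArg e hx.apply_eq_smul
      simpa [e] using h
    refine ⟨x, A *ᵥ x, 1, μ, fun h => hx.2 (Subtype.ext (hinj x x.2 h)), Or.inl one_ne_zero,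
      (one_smul _ _).symm, congrArg Subtype.val hgx⟩
  · push Not at hinj
    obtain ⟨x, hxR, hx, hx0⟩ := hinj
    exact ⟨x, Aᴴ *ᵥ x, 0, 1, fun h => hx0 (hR x hxR hx h), Or.inr one_ne_zero,
      by rw [hx, zero_smul], (one_smul _ _).symm⟩

theorem finite_setOf_sub_mul_eq_zero {p q : ℂ} (h : p ≠ 0 ∨ q ≠ 0) :
    {lam : ℂ | p - lam * q = 0}.Finite := by
  refine Set.Subsingleton.finite fun a ha b hb => ?_
  simp only [Set.mem_ofPred_eq] at ha hb
  have hq : q ≠ 0 := by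
    rintro rfl
    simp_all
  exact mul_right_cancel₀ hq (by linear_combination hb - ha)

theorem hasStarDecomposition_of_rank_le (r : ℕ) : ∀ (A : Matrix (Fin n) (Fin n) ℂ) (S : Set ℂ),
    S.Finite → (∀ lam ∉ S, (A - lam • Aᴴ).rank ≤ r) → HasStarDecomposition A r := by
  induction r using Nat.strong_induction_on with
  | _ r ih =>
  intro A S hS hrank
  by_cases hA : A = 0
  · exact hA ▸ HasStarDecomposition.zero n r
  obtain ⟨x, v, p, q, hv, hpq, hp, hq⟩ :=
    exists_mulVec_eq_smul_and_conjTranspose_mulVec_eq_smul hA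
  have hpq' : star q ≠ 0 ∨ star p ≠ 0 := by
    simpa [or_comm] using hpq
  set T : Set ℂ := S ∪ {lam | p - lam * q = 0} ∪ {lam | star q - lam * star p = 0}
  have hTfin : T.Finite :=
    (hS.union (finite_setOf_sub_mul_eq_zero hpq)).union (finite_setOf_sub_mul_eq_zero hpq')
  obtain ⟨lam₀, hlam₀⟩ := hTfin.infinite_compl.nonempty
  have hTS : ∀ lam ∉ T, lam ∉ S := fun lam h h' => h (Or.inl (Or.inl h'))
  have hMx : ∀ lam : ℂ, (A - lam • Aᴴ) *ᵥ x = (p - lam * q) • v := fun lam => by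
    rw [sub_mulVec, smul_mulVec, hp, hq, smul_smul, sub_smul]
  have hMx0 : ∀ lam ∉ T, (A - lam • Aᴴ) *ᵥ x ≠ 0 := fun lam h => by
    rw [hMx]
    exact smul_ne_zero (fun h' => h (Or.inl (Or.inr h'))) hv
  have hperp : ∀ lam ∉ T, ∀ y, (A - lam • Aᴴ) *ᵥ y = 0 → star v ⬝ᵥ y = 0 := by
    intro lam h y hy
    have h1 : star x ⬝ᵥ (A - lam • Aᴴ) *ᵥ y = (star q - lam * star p) * (star v ⬝ᵥ y) := by
      rw [sub_mulVec, smul_mulVec, dotProduct_sub, dotProduct_smul, star_dotProduct_mulVec_eq,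
        star_dotProduct_mulVec_eq, conjTranspose_conjTranspose, hp, hq]
      simp only [star_smul, smul_dotProduct, smul_eq_mul]
      ring
    rw [hy, dotProduct_zero] at h1
    exact (mul_eq_zero.1 h1.symm).resolve_left fun h' => h (Or.inr h')
  have hstar : star (star v ⬝ᵥ x) = star x ⬝ᵥ v := by
    rw [star_dotProduct, star_star]
  by_cases hvx : star v ⬝ᵥ x = 0
  · have hvv : star v ⬝ᵥ v ≠ 0 := fun h => hv (dotProduct_star_self_eq_zero.1 h)
    set t : ℂ := (star v ⬝ᵥ v)⁻¹ with ht
    have htstar : star t = t := by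
      rw [ht, star_inv₀, ← star_dotProduct]
    set P : Matrix (Fin n) (Fin n) ℂ := 1 - t • vecMulVec v (star v) with hP
    have hPH : Pᴴ = P := by
      rw [hP, conjTranspose_sub, conjTranspose_one, conjTranspose_smul, htstar,
        conjTranspose_vecMulVec, star_star]
    have hPy : ∀ y, P *ᵥ y = y - (t * (star v ⬝ᵥ y)) • v := fun y => by
      rw [hP, sub_mulVec, one_mulVec, smul_mulVec, vecMulVec_mulVec, op_smul_eq_smul, smul_smul]
    have hPv : P *ᵥ v = 0 := by
      rw [hPy, ht, inv_mul_cancel₀ hvv, one_smul, sub_self]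
    have hPfix : ∀ y, star v ⬝ᵥ y = 0 → P *ᵥ y = y := fun y hy => by
      rw [hPy, hy, mul_zero, zero_smul, sub_zero]
    have hpencil : ∀ lam : ℂ,
        P * A * P - lam • (P * A * P)ᴴ = P * (A - lam • Aᴴ) * P := fun lam => by
      simp only [conjTranspose_mul, hPH, mul_sub, sub_mul, mul_assoc, Matrix.mul_smul,
        Matrix.smul_mul]
    have hdrop : ∀ lam ∉ T, (P * A * P - lam • (P * A * P)ᴴ).rank + 2 ≤ r := by
      intro lam h
      refine le_trans ?_ (hrank lam (hTS lam h))
      rw [hpencil]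
      refine rank_add_two_le_of_ker_le (x := x) (v := v) (fun y hy => ?_) ?_ (hMx0 lam h) ?_ hv
        (hperp lam h) hvx
      · rw [← mulVec_mulVec, hPfix y (hperp lam h y hy), ← mulVec_mulVec, hy, mulVec_zero]
      · rw [← mulVec_mulVec, hPfix x hvx, ← mulVec_mulVec, hMx, mulVec_smul, hPv, smul_zero]
      · rw [← mulVec_mulVec, hPv, mulVec_zero]
    obtain ⟨k, rfl⟩ : ∃ k, r = k + 2 := ⟨r - 2, by have := hdrop lam₀ hlam₀; omega⟩
    have hdec := ih k (by omega) (P * A * P) T hTfin fun lam h => by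
      have := hdrop lam h
      omega
    convert hdec.vecMulVec_sub_add v (t • Aᴴ *ᵥ v) (-(t • P *ᵥ A *ᵥ v)) using 1
    have h1 : vecMulVec v (star (t • Aᴴ *ᵥ v)) = t • (vecMulVec v (star v) * A) := by
      rw [star_smul, htstar, vecMulVec_smul, star_mulVec, conjTranspose_conjTranspose,
        vecMulVec_mul]
    have h2 : vecMulVec (-(t • P *ᵥ A *ᵥ v)) (star v) = -(t • (P * A * vecMulVec v (star v))) := by
      rw [neg_vecMulVec, smul_vecMulVec, mul_vecMulVec, mulVec_mulVec]
    have hQ : t • vecMulVec v (star v) = 1 - P := by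
      rw [hP, sub_sub_cancel]
    rw [h1, h2, ← Matrix.smul_mul, ← Matrix.mul_smul, hQ]
    noncomm_ring
  · set z : ℂ := p / (star v ⬝ᵥ x) with hz
    have hxv : star x ⬝ᵥ v ≠ 0 := by
      rw [← hstar]
      exact star_ne_zero.2 hvx
    have hqz : star z * (star v ⬝ᵥ x) = q := by
      have h1 : star x ⬝ᵥ Aᴴ *ᵥ x = star p * (star v ⬝ᵥ x) := by
        rw [star_dotProduct_mulVec_eq, conjTranspose_conjTranspose, hp, star_smul,
          smul_dotProduct, smul_eq_mul]
      rw [hq, dotProduct_smul, smul_eq_mul] at h1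
      rw [hz, star_div₀, hstar, div_mul_eq_mul_div, ← h1, mul_div_cancel_right₀ _ hxv]
    set A' : Matrix (Fin n) (Fin n) ℂ := A - z • vecMulVec v (star v) with hA'
    have hpencil : ∀ (lam : ℂ) y, (A' - lam • A'ᴴ) *ᵥ y =
        (A - lam • Aᴴ) *ᵥ y - ((z - lam * star z) * (star v ⬝ᵥ y)) • v := fun lam y => by
      simp only [hA', conjTranspose_sub, conjTranspose_smul, conjTranspose_vecMulVec, star_star,
        sub_mulVec, smul_mulVec, vecMulVec_mulVec, op_smul_eq_smul]
      module
    have hdrop : ∀ lam ∉ T, (A' - lam • A'ᴴ).rank + 1 ≤ r := by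
      intro lam h
      refine le_trans ?_ (hrank lam (hTS lam h))
      refine rank_add_one_le_of_ker_le (x := x) (fun y hy => ?_) ?_ (hMx0 lam h)
      · rw [hpencil, hy, hperp lam h y hy, mul_zero, zero_smul, sub_zero]
      · rw [hpencil, hMx, sub_mul, mul_assoc, hqz, hz, div_mul_cancel₀ _ hvx, sub_self]
    obtain ⟨k, rfl⟩ : ∃ k, r = k + 1 := ⟨r - 1, by have := hdrop lam₀ hlam₀; omega⟩
    have hdec := ih k (by omega) A' T hTfin fun lam h => by
      have := hdrop lam h
      omega
    convert hdec.smul_vecMulVec_add z v using 1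
    rw [hA', add_sub_cancel]

end Pencil

/-- **Rank-1 decomposition for *-anti-palindromic pencils.**
If `E(λ) = A + λB` is an `n × n` *-anti-palindromic matrix pencil (`Aᴴ = -B`) of rank
`r ≤ n`, then there exist `ℓ, s` with `ℓ + 2s = r`, real numbers `a_i, b_i`, vectors
`u_i, v_j ∈ ℂ^n`, and vector pencils `w_j(λ) = c_j + λ d_j` of degree at most one
(so `rev w_j(λ) = d_j + λ c_j`) such that
`A + λB = Σ ((a_i + 𝕚 b_i) + λ(−a_i + 𝕚 b_i)) u_i u_i^* + Σ (v_j w_j(λ)^* − (rev w_j)(λ) v_j^*)`. -/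
theorem star_anti_palindromic_rank_one_decomposition
    (n r : ℕ) (hrn : r ≤ n) (A B : Matrix (Fin n) (Fin n) ℂ)
    (hAB : Aᴴ = -B)
    (hrank : PencilRankEq n A B r) :
    ∃ (ℓ s : ℕ), ℓ + 2 * s = r ∧
      ∃ (a b : Fin ℓ → ℝ) (u : Fin ℓ → Fin n → ℂ)
        (v c d : Fin s → Fin n → ℂ),
        ∀ lam : ℂ,
          A + lam • B =
            (∑ i : Fin ℓ,
              (((a i : ℂ) + Complex.I * (b i : ℂ))
                + lam * (-(a i : ℂ) + Complex.I * (b i : ℂ))) • vecMulVec (u i) (star (u i)))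
            + ∑ j : Fin s,
                (vecMulVec (v j) (star (c j) + lam • star (d j))
                  - vecMulVec (d j + lam • c j) (star (v j))) := by
  have hB : B = -Aᴴ := by rw [hAB, neg_neg]
  obtain ⟨ℓ, s, hr, z, u, v, c, d, hdec⟩ :=
    hasStarDecomposition_of_rank_le r A ∅ Set.finite_empty fun lam _ => by
      have h := hrank.2 lam
      rwa [hB, smul_neg, ← sub_eq_add_neg] at h
  have hdecH : Aᴴ = (∑ i, star (z i) • vecMulVec (u i) (star (u i)))
      + ∑ j, (vecMulVec (c j) (star (v j)) - vecMulVec (v j) (star (d j))) := by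
    rw [hdec]
    simp [conjTranspose_sum, conjTranspose_vecMulVec]
  refine ⟨ℓ, s, hr, fun i => (z i).re, fun i => (z i).im, u, v, c, d, fun lam => ?_⟩
  rw [hB, hdecH, hdec, smul_neg, smul_add, Finset.smul_sum, Finset.smul_sum, neg_add,
    ← Finset.sum_neg_distrib, ← Finset.sum_neg_distrib, add_add_add_comm,
    ← Finset.sum_add_distrib, ← Finset.sum_add_distrib]
  congr 1 <;> refine Finset.sum_congr rfl fun i _ => ?_
  · have h1 : ((z i).re : ℂ) + Complex.I * (z i).im = z i := by
      rw [mul_comm, Complex.re_add_im]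
    have h2 : -((z i).re : ℂ) + Complex.I * (z i).im = -star (z i) := by
      apply Complex.ext <;> simp
    rw [h1, h2]
    module
  · simp only [vecMulVec_add, add_vecMulVec, vecMulVec_smul, smul_vecMulVec]
    module
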